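/- (Realizability conditions (17)–(18)) Let V be a nonempty finite set and κ, δ : V → ℕ with ∑_{i∈V} κ_i = ∑_{i∈V} δ_i = l. There exists a matrix A : V × V → ℕ with zero diagonal (A_{ii} = 0 for all i), row sums ∑_{j} A_{ij} = κ_i, and column sums ∑_{j} A_{ji} = δ_i — i.e., a directed multigraph without self-loops with out-degrees κ and in-degrees δ — if and only if κ_i + δ_i ≤ l for every i ∈ V. -/

import Mathlib

/-- If the degree bound holds with a positive number of links, then there are distinct nodes `a` and
`b`, with positive out-degree and in-degree respectively, such that every node attaining the bound
is `a` or `b`. -/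
lemma exists_link_of_add_le {V : Type*} [Fintype V] [DecidableEq V] {κ δ : V → ℕ} {l : ℕ}
    (hκ : ∑ i, κ i = l + 1) (hδ : ∑ i, δ i = l + 1) (h : ∀ i, κ i + δ i ≤ l + 1) :
    ∃ a b, a ≠ b ∧ 0 < κ a ∧ 0 < δ b ∧ ∀ i, i ≠ a → i ≠ b → κ i + δ i ≤ l := by
  obtain ⟨a, ha, hat⟩ : ∃ a, 0 < κ a ∧
      (κ a + δ a = l + 1 ∨ ∀ i, κ i + δ i = l + 1 → κ i = 0) := by
    by_cases ht : ∃ i, 0 < κ i ∧ κ i + δ i = l + 1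
    · obtain ⟨a, ha, hat⟩ := ht
      exact ⟨a, ha, Or.inl hat⟩
    · obtain ⟨a, -, ha⟩ : ∃ a ∈ Finset.univ, κ a ≠ 0 :=
        Finset.exists_ne_zero_of_sum_ne_zero (by omega)
      exact ⟨a, Nat.pos_of_ne_zero ha, Or.inr fun i hi ↦ by
        by_contra hne
        exact ht ⟨i, Nat.pos_of_ne_zero hne, hi⟩⟩
  have hsplit := Finset.add_sum_erase Finset.univ δ (Finset.mem_univ a)
  obtain ⟨b, hb, hb0⟩ : ∃ b ∈ Finset.univ.erase a, δ b ≠ 0 :=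
    Finset.exists_ne_zero_of_sum_ne_zero (by have := h a; omega)
  have hba : b ≠ a := Finset.ne_of_mem_erase hb
  refine ⟨a, b, hba.symm, ha, Nat.pos_of_ne_zero hb0, fun i hia hib ↦ ?_⟩
  by_contra hi
  have hi := le_antisymm (h i) (by omega)
  have hκ2 : κ i + κ a ≤ l + 1 := by
    rw [← hκ, ← Finset.sum_pair hia]
    exact Finset.sum_le_sum_of_subset (Finset.subset_univ _)
  have hδ3 : δ i + (δ a + δ b) ≤ l + 1 := by
    rw [← hδ, ← Finset.sum_pair hba.symm, ← Finset.sum_insert (by simp [hia, hib])]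
    exact Finset.sum_le_sum_of_subset (Finset.subset_univ _)
  rcases hat with hat | hat
  · omega
  · have := hat i hi
    omega

/-- Degree sequences satisfying the degree bound are realized by a loopless directed multigraph. -/
lemma exists_loopless_of_add_le {V : Type*} [Fintype V] [DecidableEq V] {l : ℕ} {κ δ : V → ℕ}
    (hκ : ∑ i, κ i = l) (hδ : ∑ i, δ i = l) (h : ∀ i, κ i + δ i ≤ l) :
    ∃ A : V → V → ℕ, (∀ i, A i i = 0) ∧
      (∀ i, ∑ j, A i j = κ i) ∧ (∀ i, ∑ j, A j i = δ i) := by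
  induction l generalizing κ δ with
  | zero =>
    refine ⟨fun _ _ ↦ 0, fun _ ↦ rfl, fun i ↦ ?_, fun i ↦ ?_⟩ <;>
    · have := h i
      simp only [Finset.sum_const_zero]
      omega
  | succ l ih =>
    obtain ⟨a, b, hab, ha, hb, hmax⟩ := exists_link_of_add_le hκ hδ h
    obtain ⟨κ', rfl⟩ : ∃ κ' : V → ℕ, κ = fun i ↦ κ' i + if i = a then 1 else 0 :=
      ⟨fun i ↦ κ i - if i = a then 1 else 0, by
        funext i; dsimp only; split_ifs with hi
        · subst hi; omega
        · omega⟩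
    obtain ⟨δ', rfl⟩ : ∃ δ' : V → ℕ, δ = fun i ↦ δ' i + if i = b then 1 else 0 :=
      ⟨fun i ↦ δ i - if i = b then 1 else 0, by
        funext i; dsimp only; split_ifs with hi
        · subst hi; omega
        · omega⟩
    obtain ⟨A, hA, hrow, hcol⟩ := ih (κ := κ') (δ := δ')
      (by simpa [Finset.sum_add_distrib] using hκ) (by simpa [Finset.sum_add_distrib] using hδ)
      (fun i ↦ by
        have h1 := h i
        have h2 := hmax i
        dsimp only at h1 h2
        by_cases hia : i = a
        · simp only [hia, if_true] at h1 ⊢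
          omega
        · by_cases hib : i = b
          · simp only [hib, if_true] at h1 ⊢
            omega
          · have := h2 hia hib
            omega)
    refine ⟨fun i j ↦ A i j + if i = a ∧ j = b then 1 else 0, fun i ↦ ?_, fun i ↦ ?_, fun i ↦ ?_⟩
    · have : ¬(i = a ∧ i = b) := fun hi ↦ hab (hi.1.symm.trans hi.2)
      simp [hA, this]
    · simp [Finset.sum_add_distrib, hrow, ite_and]
    · simp [Finset.sum_add_distrib, hcol, ite_and]

/-- (Realizability conditions (17)–(18)) Given out-degrees `κ` and in-degrees
`δ` on a nonempty finite node set `V` with equal totals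
`∑ κ_i = ∑ δ_i = l`, a directed multigraph without self-loops realizing these
degrees exists if and only if `κ_i + δ_i ≤ l` for every node `i`. -/
theorem directed_multigraph_realizable_iff
    {V : Type*} [Fintype V] [Nonempty V] [DecidableEq V]
    (κ δ : V → ℕ) (l : ℕ)
    (hκ : ∑ i, κ i = l) (hδ : ∑ i, δ i = l) :
    (∃ A : V → V → ℕ, (∀ i, A i i = 0) ∧
        (∀ i, ∑ j, A i j = κ i) ∧ (∀ i, ∑ j, A j i = δ i)) ↔
      ∀ i, κ i + δ i ≤ l := by
  refine ⟨?_, exists_loopless_of_add_le hκ hδ⟩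
  rintro ⟨A, hA, hrow, hcol⟩ i
  have hle : ∑ k ∈ Finset.univ.erase i, A k i ≤ ∑ k ∈ Finset.univ.erase i, κ k :=
    Finset.sum_le_sum fun k _ ↦ hrow k ▸
      Finset.single_le_sum (f := A k) (fun _ _ ↦ Nat.zero_le _) (Finset.mem_univ i)
  have hδi := Finset.add_sum_erase Finset.univ (fun k ↦ A k i) (Finset.mem_univ i)
  have hκi := Finset.add_sum_erase Finset.univ κ (Finset.mem_univ i)
  have := hcol i
  have := hA i
  omega
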